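/- Let Φ : D² → ℝ³ be a smooth immersion and let α, β, γ ∈ ℝ. Define the vector fields W^j := − α g^{jk}∂_kΦ + (β/2) |g|^{−1/2} ε^{kj} Φ×∂_kΦ + (γ/2)( g^{kl}g^{jm}h_{lm} − 2H g^{kj} ) ∂_kΦ for j = 1,2. Then, pointwise on D²: |g|^{−1/2} ∂_j( |g|^{1/2} W^j ) = − [ 2αH n + β n − γ( (1/2) g^{ik}g^{jl}h_{kj}h_{li} − 2H² ) n ]; that is, V with ∇^jV = W^j solves Δ_g V = −W⃗_{Helfrich}, where W⃗_{Helfrich} := 2αH⃗ + β n − γ( (1/2) h^i_j h^j_i − 2H² ) n is the right-hand side of the Helfrich (bilayer) Euler–Lagrange equation. -/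

import Mathlib

noncomputable section

open scoped RealInnerProductSpace

abbrev E2 : Type := EuclideanSpace ℝ (Fin 2)
abbrev E3 : Type := EuclideanSpace ℝ (Fin 3)

/-- Partial derivative of a map on `ℝ²` in the `i`-th coordinate direction. -/
def pd {F : Type*} [NormedAddCommGroup F] [NormedSpace ℝ F]
    (i : Fin 2) (f : E2 → F) (x : E2) : F :=
  fderiv ℝ f x (EuclideanSpace.single i 1)

/-- Cross product on `ℝ³`. -/
def cross3 (u v : E3) : E3 :=
  (WithLp.equiv 2 (Fin 3 → ℝ)).symm
    ![u 1 * v 2 - u 2 * v 1, u 2 * v 0 - u 0 * v 2, u 0 * v 1 - u 1 * v 0]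

/-- Induced metric. -/
def gm (Φ : E2 → E3) (x : E2) (i j : Fin 2) : ℝ :=
  ⟪pd i Φ x, pd j Φ x⟫

/-- Determinant of the induced metric. -/
def gdet (Φ : E2 → E3) (x : E2) : ℝ :=
  gm Φ x 0 0 * gm Φ x 1 1 - gm Φ x 0 1 * gm Φ x 1 0

/-- Inverse metric. -/
def ginv (Φ : E2 → E3) (x : E2) (i j : Fin 2) : ℝ :=
  (Matrix.of (gm Φ x))⁻¹ i j

/-- Unit normal. -/
def nrm (Φ : E2 → E3) (x : E2) : E3 :=
  ‖cross3 (pd 0 Φ x) (pd 1 Φ x)‖⁻¹ • cross3 (pd 0 Φ x) (pd 1 Φ x)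

/-- Scalar second fundamental form. -/
def sff3 (Φ : E2 → E3) (x : E2) (i j : Fin 2) : ℝ :=
  ⟪nrm Φ x, pd i (pd j Φ) x⟫

/-- Scalar mean curvature. -/
def mc3 (Φ : E2 → E3) (x : E2) : ℝ :=
  (1/2 : ℝ) * ∑ i : Fin 2, ∑ j : Fin 2, ginv Φ x i j * sff3 Φ x i j

/-- Mean curvature vector. -/
def mcv3 (Φ : E2 → E3) (x : E2) : E3 := mc3 Φ x • nrm Φ x

/-- Levi-Civita symbol on two indices. -/
def eps (i j : Fin 2) : ℝ := ![![0, 1], ![-1, 0]] i j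

/-- The open unit disk in `ℝ²`. -/
def Disk : Set E2 := Metric.ball 0 1

/-- Immersion condition on the disk. -/
def ImmersedOn (Φ : E2 → E3) : Prop :=
  ∀ x ∈ Disk, LinearIndependent ℝ ![pd 0 Φ x, pd 1 Φ x]

end

open scoped RealInnerProductSpace

section Pointwise

theorem inner_E3 (u v : E3) : ⟪u, v⟫ = u 0 * v 0 + u 1 * v 1 + u 2 * v 2 := by
  simp [PiLp.inner_apply, Fin.sum_univ_three, mul_comm]

@[simp] theorem cross3_zero (u v : E3) : cross3 u v 0 = u 1 * v 2 - u 2 * v 1 := rfl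
@[simp] theorem cross3_one (u v : E3) : cross3 u v 1 = u 2 * v 0 - u 0 * v 2 := rfl
@[simp] theorem cross3_two (u v : E3) : cross3 u v 2 = u 0 * v 1 - u 1 * v 0 := rfl

theorem E3_ext {u v : E3} (h0 : u 0 = v 0) (h1 : u 1 = v 1) (h2 : u 2 = v 2) : u = v := by
  ext i
  fin_cases i <;> assumption

theorem cross3_add_left (u v w : E3) : cross3 (u + v) w = cross3 u w + cross3 v w := by
  apply E3_ext <;> simp <;> ring

theorem cross3_add_right (u v w : E3) : cross3 u (v + w) = cross3 u v + cross3 u w := by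
  apply E3_ext <;> simp <;> ring

theorem cross3_smul_left (c : ℝ) (u v : E3) : cross3 (c • u) v = c • cross3 u v := by
  apply E3_ext <;> simp <;> ring

theorem cross3_smul_right (c : ℝ) (u v : E3) : cross3 u (c • v) = c • cross3 u v := by
  apply E3_ext <;> simp <;> ring

theorem cross3_self (u : E3) : cross3 u u = 0 := by
  apply E3_ext <;> simp <;> ring

theorem cross3_anticomm (u v : E3) : cross3 v u = -cross3 u v := by
  apply E3_ext <;> simp <;> ring

theorem cross3_cross3_left (u v w : E3) :
    cross3 (cross3 u v) w = ⟪u, w⟫ • v - ⟪v, w⟫ • u := by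
  simp only [inner_E3]
  apply E3_ext <;> simp <;> ring

theorem inner_cross3_left (u v : E3) : ⟪cross3 u v, u⟫ = 0 := by
  simp only [inner_E3, cross3_zero, cross3_one, cross3_two]; ring

theorem inner_cross3_right (u v : E3) : ⟪cross3 u v, v⟫ = 0 := by
  simp only [inner_E3, cross3_zero, cross3_one, cross3_two]; ring

/-- Lagrange's identity. -/
theorem norm_cross3_sq (u v : E3) :
    ‖cross3 u v‖ ^ 2 = ⟪u, u⟫ * ⟪v, v⟫ - ⟪u, v⟫ * ⟪v, u⟫ := by
  rw [← real_inner_self_eq_norm_sq]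
  simp only [inner_E3, cross3_zero, cross3_one, cross3_two]; ring

/-- Expansion of a vector in the frame `u, v, u × v`. -/
theorem frame_expansion (u v d : E3) :
    (⟪u, u⟫ * ⟪v, v⟫ - ⟪u, v⟫ ^ 2) • d
      = (⟪d, u⟫ * ⟪v, v⟫ - ⟪d, v⟫ * ⟪u, v⟫) • u
        + (⟪d, v⟫ * ⟪u, u⟫ - ⟪d, u⟫ * ⟪u, v⟫) • v
        + ⟪d, cross3 u v⟫ • cross3 u v := by
  simp only [inner_E3]
  apply E3_ext <;> simp <;> ring

theorem cross3_ne_zero {u v : E3} (h : LinearIndependent ℝ ![u, v]) : cross3 u v ≠ 0 := by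
  intro h0
  rw [LinearIndependent.pair_iff] at h
  have h1 := cross3_cross3_left u v v
  have h2 : cross3 (cross3 u v) v = 0 := by rw [h0]; apply E3_ext <;> simp
  have h3 := (h (-⟪v, v⟫) ⟪u, v⟫ (by rw [← h2, h1]; module)).1
  have h4 : v = 0 := by simpa using h3
  simpa using (h 0 1 (by simp [h4])).2

end Pointwise

section Calculus

variable {f g : E2 → E3} {x : E2}

theorem pd_apply (i : Fin 2) (k : Fin 3) (hf : DifferentiableAt ℝ f x) :
    pd i f x k = fderiv ℝ (fun y => f y k) x (EuclideanSpace.single i 1) := by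
  have h : HasFDerivAt (fun y => f y k)
      ((EuclideanSpace.proj k : E3 →L[ℝ] ℝ).comp (fderiv ℝ f x)) x :=
    (EuclideanSpace.proj k : E3 →L[ℝ] ℝ).hasFDerivAt.comp x hf.hasFDerivAt
  rw [h.fderiv]; rfl

theorem differentiableAt_coord (k : Fin 3) (hf : DifferentiableAt ℝ f x) :
    DifferentiableAt ℝ (fun y => f y k) x :=
  (EuclideanSpace.proj k : E3 →L[ℝ] ℝ).differentiableAt.comp x hf

theorem contDiffAt_cross3 {m : WithTop ℕ∞} (hf : ContDiffAt ℝ m f x) (hg : ContDiffAt ℝ m g x) :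
    ContDiffAt ℝ m (fun y => cross3 (f y) (g y)) x := by
  have hf' := fun k => (contDiffAt_euclidean.1 hf) k
  have hg' := fun k => (contDiffAt_euclidean.1 hg) k
  refine contDiffAt_euclidean.2 fun k => ?_
  fin_cases k
  · exact ((hf' 1).mul (hg' 2)).sub ((hf' 2).mul (hg' 1))
  · exact ((hf' 2).mul (hg' 0)).sub ((hf' 0).mul (hg' 2))
  · exact ((hf' 0).mul (hg' 1)).sub ((hf' 1).mul (hg' 0))

theorem DifferentiableAt.cross3 (hf : DifferentiableAt ℝ f x) (hg : DifferentiableAt ℝ g x) :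
    DifferentiableAt ℝ (fun y => cross3 (f y) (g y)) x := by
  have hf' := fun k => differentiableAt_coord k hf
  have hg' := fun k => differentiableAt_coord k hg
  refine differentiableAt_euclidean.2 fun k => ?_
  fin_cases k
  · exact ((hf' 1).mul (hg' 2)).sub ((hf' 2).mul (hg' 1))
  · exact ((hf' 2).mul (hg' 0)).sub ((hf' 0).mul (hg' 2))
  · exact ((hf' 0).mul (hg' 1)).sub ((hf' 1).mul (hg' 0))

theorem pd_cross3 (i : Fin 2) (hf : DifferentiableAt ℝ f x) (hg : DifferentiableAt ℝ g x) :
    pd i (fun y => cross3 (f y) (g y)) x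
      = cross3 (pd i f x) (g x) + cross3 (f x) (pd i g x) := by
  have hf' := fun k => differentiableAt_coord k hf
  have hg' := fun k => differentiableAt_coord k hg
  have key : ∀ a b : Fin 3,
      fderiv ℝ (fun y => f y a * g y b - f y b * g y a) x (EuclideanSpace.single i 1)
        = pd i f x a * g x b + f x a * pd i g x b
          - (pd i f x b * g x a + f x b * pd i g x a) := by
    intro a b
    rw [fderiv_fun_sub ((hf' a).fun_mul (hg' b)) ((hf' b).fun_mul (hg' a)),
      fderiv_fun_mul (hf' a) (hg' b), fderiv_fun_mul (hf' b) (hg' a)]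
    simp [pd_apply i _ hf, pd_apply i _ hg]
    ring
  apply E3_ext <;> rw [pd_apply i _ (hf.cross3 hg)] <;>
    simp only [cross3_zero, cross3_one, cross3_two, PiLp.add_apply, key] <;> ring

theorem pd_add (i : Fin 2) (hf : DifferentiableAt ℝ f x) (hg : DifferentiableAt ℝ g x) :
    pd i (fun y => f y + g y) x = pd i f x + pd i g x := by
  simp [pd, fderiv_fun_add hf hg]

theorem pd_const_smul (i : Fin 2) (c : ℝ) (hf : DifferentiableAt ℝ f x) :
    pd i (fun y => c • f y) x = c • pd i f x := by
  simp [pd, fderiv_fun_const_smul hf c]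

theorem pd_congr (i : Fin 2) {f g : E2 → E3} (h : f =ᶠ[nhds x] g) : pd i f x = pd i g x := by
  rw [pd, h.fderiv_eq, pd]

theorem pd_inner (i : Fin 2) (hf : DifferentiableAt ℝ f x) (hg : DifferentiableAt ℝ g x) :
    pd i (fun y => ⟪f y, g y⟫) x = ⟪f x, pd i g x⟫ + ⟪pd i f x, g x⟫ :=
  fderiv_inner_apply ℝ hf hg _

theorem contDiffAt_pd (i : Fin 2) (hf : ContDiffAt ℝ (⊤ : ℕ∞) f x) :
    ContDiffAt ℝ (⊤ : ℕ∞) (pd i f) x :=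
  (hf.fderiv_right (m := (⊤ : ℕ∞)) (by simp)).clm_apply contDiffAt_const

theorem pd_comm (i j : Fin 2) (hf : ContDiffAt ℝ (⊤ : ℕ∞) f x) :
    pd i (pd j f) x = pd j (pd i f) x := by
  have hd : DifferentiableAt ℝ (fderiv ℝ f) x :=
    (hf.fderiv_right (m := (⊤ : ℕ∞)) (by simp)).differentiableAt (by simp)
  have h : ∀ a b, pd a (pd b f) x
      = fderiv ℝ (fderiv ℝ f) x (EuclideanSpace.single a 1) (EuclideanSpace.single b 1) := by
    intro a b
    have : pd b f = fun y => fderiv ℝ f y (EuclideanSpace.single b 1) := rfl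
    rw [this, pd, fderiv_clm_apply hd (by fun_prop)]
    simp
  rw [h, h]
  exact (hf.isSymmSndFDerivAt (by simpa using WithTop.coe_le_coe.2 (le_top : (2 : ℕ∞) ≤ ⊤))) _ _

/-- The divergence of a rotated gradient `f × ∇^⊥ g` contains no second derivatives. -/
theorem pd_cross3_pd_sub (hf : ContDiffAt ℝ (⊤ : ℕ∞) f x) (hg : ContDiffAt ℝ (⊤ : ℕ∞) g x) :
    pd 0 (fun y => cross3 (f y) (pd 1 g y)) x - pd 1 (fun y => cross3 (f y) (pd 0 g y)) x
      = cross3 (pd 0 f x) (pd 1 g x) - cross3 (pd 1 f x) (pd 0 g x) := by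
  have hf' := hf.differentiableAt (by simp)
  have hg' := fun i => (contDiffAt_pd i hg).differentiableAt (by simp)
  rw [pd_cross3 0 hf' (hg' 1), pd_cross3 1 hf' (hg' 0), pd_comm 1 0 hg]
  abel

end Calculus

section Surface

variable {Φ : E2 → E3} {x : E2}

theorem contDiffAt_nrm (hΦ : ContDiffAt ℝ (⊤ : ℕ∞) Φ x)
    (hx : cross3 (pd 0 Φ x) (pd 1 Φ x) ≠ 0) : ContDiffAt ℝ (⊤ : ℕ∞) (nrm Φ) x := by
  have h := contDiffAt_cross3 (contDiffAt_pd 0 hΦ) (contDiffAt_pd 1 hΦ)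
  exact ((h.norm ℝ hx).inv (norm_ne_zero_iff.2 hx)).smul h

theorem sqrt_gdet (Φ : E2 → E3) (x : E2) :
    Real.sqrt (gdet Φ x) = ‖cross3 (pd 0 Φ x) (pd 1 Φ x)‖ := by
  rw [gdet, gm, gm, gm, gm, ← norm_cross3_sq, Real.sqrt_sq (norm_nonneg _)]

theorem inner_nrm_pd (Φ : E2 → E3) (y : E2) (k : Fin 2) : ⟪nrm Φ y, pd k Φ y⟫ = 0 := by
  rw [nrm, real_inner_smul_left]
  fin_cases k
  · simp [inner_cross3_left]
  · simp [inner_cross3_right]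

theorem inner_nrm_self (hx : cross3 (pd 0 Φ x) (pd 1 Φ x) ≠ 0) : ⟪nrm Φ x, nrm Φ x⟫ = 1 := by
  rw [real_inner_self_eq_norm_sq, nrm, norm_smul, norm_inv, norm_norm,
    inv_mul_cancel₀ (norm_ne_zero_iff.2 hx), one_pow]

theorem inner_pd_nrm_pd (hΦ : ContDiffAt ℝ (⊤ : ℕ∞) Φ x)
    (hx : cross3 (pd 0 Φ x) (pd 1 Φ x) ≠ 0) (i j : Fin 2) :
    ⟪pd i (nrm Φ) x, pd j Φ x⟫ = -sff3 Φ x i j := by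
  have h := pd_inner i ((contDiffAt_nrm hΦ hx).differentiableAt (by simp))
    ((contDiffAt_pd j hΦ).differentiableAt (by simp))
  simp only [inner_nrm_pd] at h
  have h0 : pd i (fun _ : E2 => (0 : ℝ)) x = 0 := by simp [pd]
  rw [h0] at h
  rw [sff3]; linarith

theorem sff3_comm (hΦ : ContDiffAt ℝ (⊤ : ℕ∞) Φ x) : sff3 Φ x 1 0 = sff3 Φ x 0 1 := by
  rw [sff3, pd_comm 1 0 hΦ, sff3]

theorem inner_pd_nrm_nrm (hΦ : ContDiffAt ℝ (⊤ : ℕ∞) Φ x)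
    (hx : ∀ᶠ y in nhds x, cross3 (pd 0 Φ y) (pd 1 Φ y) ≠ 0) (i : Fin 2) :
    ⟪pd i (nrm Φ) x, nrm Φ x⟫ = 0 := by
  have hn := (contDiffAt_nrm hΦ hx.self_of_nhds).differentiableAt (by simp)
  have h := pd_inner i hn hn
  have hc : (fun y => ⟪nrm Φ y, nrm Φ y⟫) =ᶠ[nhds x] fun _ => 1 :=
    hx.mono fun y hy => inner_nrm_self hy
  have h0 : pd i (fun y => ⟪nrm Φ y, nrm Φ y⟫) x = 0 := by
    rw [pd, hc.fderiv_eq]; simp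
  rw [h0, real_inner_comm] at h
  linarith

theorem gm_comm (Φ : E2 → E3) (x : E2) : gm Φ x 1 0 = gm Φ x 0 1 := real_inner_comm _ _

theorem gdet_eq_sq (Φ : E2 → E3) (x : E2) : gdet Φ x = Real.sqrt (gdet Φ x) ^ 2 := by
  rw [sqrt_gdet, norm_cross3_sq]; rfl

/-- The metric is the cofactor matrix of its inverse, and the latter has determinant `1 / |g|`. -/
theorem gm_eq_ginv (hx : Real.sqrt (gdet Φ x) ≠ 0) :
    gm Φ x 0 0 = Real.sqrt (gdet Φ x) ^ 2 * ginv Φ x 1 1 ∧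
    gm Φ x 0 1 = -(Real.sqrt (gdet Φ x) ^ 2 * ginv Φ x 0 1) ∧
    gm Φ x 1 1 = Real.sqrt (gdet Φ x) ^ 2 * ginv Φ x 0 0 ∧
    ginv Φ x 1 0 = ginv Φ x 0 1 ∧
    Real.sqrt (gdet Φ x) ^ 2 * (ginv Φ x 0 0 * ginv Φ x 1 1 - ginv Φ x 0 1 ^ 2) = 1 := by
  have hd : gdet Φ x ≠ 0 := fun h => hx (by simp [h])
  have hdet : (Matrix.of (gm Φ x)).det = gdet Φ x := by
    rw [Matrix.det_fin_two]; rfl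
  have hg : ∀ i j, ginv Φ x i j = (gdet Φ x)⁻¹ *
      (!![gm Φ x 1 1, -gm Φ x 0 1; -gm Φ x 0 1, gm Φ x 0 0] : Matrix _ _ ℝ) i j := by
    intro i j
    rw [ginv, Matrix.inv_def, hdet, Matrix.adjugate_fin_two]
    simp [gm_comm Φ x]
  rw [← gdet_eq_sq]
  simp only [hg]
  have hD : gdet Φ x = gm Φ x 0 0 * gm Φ x 1 1 - gm Φ x 0 1 ^ 2 := by
    rw [gdet, gm_comm]; ring
  refine ⟨?_, ?_, ?_, ?_, ?_⟩
  · simp [hd]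
  · simp [hd]
  · simp [hd]
  · simp
  · simp
    field_simp
    rw [hD]; ring

theorem cross3_pd_pd (hx : Real.sqrt (gdet Φ x) ≠ 0) :
    cross3 (pd 0 Φ x) (pd 1 Φ x) = Real.sqrt (gdet Φ x) • nrm Φ x := by
  rw [nrm, ← sqrt_gdet, smul_inv_smul₀ hx]

theorem cross3_nrm_pd_zero (hx : Real.sqrt (gdet Φ x) ≠ 0) :
    cross3 (nrm Φ x) (pd 0 Φ x)
      = Real.sqrt (gdet Φ x) • (ginv Φ x 0 1 • pd 0 Φ x + ginv Φ x 1 1 • pd 1 Φ x) := by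
  obtain ⟨hE, hF, hG, hs, hd⟩ := gm_eq_ginv hx
  have h := cross3_cross3_left (pd 0 Φ x) (pd 1 Φ x) (pd 0 Φ x)
  change _ = gm Φ x 0 0 • _ - gm Φ x 1 0 • _ at h
  rw [nrm, cross3_smul_left, h, ← sqrt_gdet, gm_comm, hE, hF]
  match_scalars <;> field_simp

theorem cross3_nrm_pd_one (hx : Real.sqrt (gdet Φ x) ≠ 0) :
    cross3 (nrm Φ x) (pd 1 Φ x)
      = -(Real.sqrt (gdet Φ x) • (ginv Φ x 0 0 • pd 0 Φ x + ginv Φ x 0 1 • pd 1 Φ x)) := by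
  obtain ⟨hE, hF, hG, hs, hd⟩ := gm_eq_ginv hx
  have h := cross3_cross3_left (pd 0 Φ x) (pd 1 Φ x) (pd 1 Φ x)
  change _ = gm Φ x 0 1 • _ - gm Φ x 1 1 • _ at h
  rw [nrm, cross3_smul_left, h, ← sqrt_gdet, hF, hG]
  match_scalars <;> field_simp

/-- The Weingarten equation `∂ᵢ n = -hᵢᵏ ∂ₖ Φ`. -/
theorem weingarten (hΦ : ContDiffAt ℝ (⊤ : ℕ∞) Φ x)
    (hev : ∀ᶠ y in nhds x, cross3 (pd 0 Φ y) (pd 1 Φ y) ≠ 0) (i : Fin 2) :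
    pd i (nrm Φ) x
      = -((ginv Φ x 0 0 * sff3 Φ x i 0 + ginv Φ x 0 1 * sff3 Φ x i 1) • pd 0 Φ x
        + (ginv Φ x 0 1 * sff3 Φ x i 0 + ginv Φ x 1 1 * sff3 Φ x i 1) • pd 1 Φ x) := by
  have hx := hev.self_of_nhds
  have hs : Real.sqrt (gdet Φ x) ≠ 0 := by rw [sqrt_gdet]; exact norm_ne_zero_iff.2 hx
  obtain ⟨hE, hF, hG, -, hd⟩ := gm_eq_ginv hs
  have h := frame_expansion (pd 0 Φ x) (pd 1 Φ x) (pd i (nrm Φ) x)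
  change (gm Φ x 0 0 * gm Φ x 1 1 - gm Φ x 0 1 ^ 2) • _ =
    (_ * gm Φ x 1 1 - _ * gm Φ x 0 1) • _ + (_ * gm Φ x 0 0 - _ * gm Φ x 0 1) • _ + _ at h
  rw [cross3_pd_pd hs, real_inner_smul_right, inner_pd_nrm_nrm hΦ hev,
    inner_pd_nrm_pd hΦ hx, inner_pd_nrm_pd hΦ hx, hE, hF, hG] at h
  have hD : Real.sqrt (gdet Φ x) ^ 2 * ginv Φ x 1 1 * (Real.sqrt (gdet Φ x) ^ 2 * ginv Φ x 0 0)
      - (-(Real.sqrt (gdet Φ x) ^ 2 * ginv Φ x 0 1)) ^ 2 = Real.sqrt (gdet Φ x) ^ 2 := by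
    linear_combination Real.sqrt (gdet Φ x) ^ 2 * hd
  rw [hD] at h
  apply smul_right_injective E3 (pow_ne_zero 2 hs)
  simp only
  rw [h]
  module

theorem cross3_nrm_pd_nrm (hΦ : ContDiffAt ℝ (⊤ : ℕ∞) Φ x)
    (hev : ∀ᶠ y in nhds x, cross3 (pd 0 Φ y) (pd 1 Φ y) ≠ 0) (i : Fin 2) :
    cross3 (nrm Φ x) (pd i (nrm Φ) x)
      = (Real.sqrt (gdet Φ x) * (ginv Φ x 0 0 * ginv Φ x 1 1 - ginv Φ x 0 1 ^ 2)) •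
        (sff3 Φ x i 1 • pd 0 Φ x - sff3 Φ x i 0 • pd 1 Φ x) := by
  have hx := hev.self_of_nhds
  have hs : Real.sqrt (gdet Φ x) ≠ 0 := by rw [sqrt_gdet]; exact norm_ne_zero_iff.2 hx
  rw [weingarten hΦ hev, ← neg_one_smul ℝ (_ + _), cross3_smul_right, cross3_add_right,
    cross3_smul_right, cross3_smul_right, cross3_nrm_pd_zero hs, cross3_nrm_pd_one hs]
  module

end Surface

/-- the Helfrich vector field `W^j` has covariant divergence equal to minus the
right-hand side of the Helfrich (bilayer) Euler–Lagrange equation. -/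
theorem helfrich_potential_divergence (Φ : E2 → E3) (α β γ : ℝ)
    (hΦ : ContDiffOn ℝ (⊤ : ℕ∞) Φ Disk) (himm : ImmersedOn Φ)
    (W : Fin 2 → E2 → E3)
    (hW : ∀ x : E2, ∀ j : Fin 2,
      W j x = -(α • ∑ k : Fin 2, ginv Φ x j k • pd k Φ x)
        + ((β / 2) * (Real.sqrt (gdet Φ x))⁻¹) •
            ∑ k : Fin 2, eps k j • cross3 (Φ x) (pd k Φ x)
        + (γ / 2) • ∑ k : Fin 2,
            ((∑ l : Fin 2, ∑ i : Fin 2, ginv Φ x k l * ginv Φ x j i * sff3 Φ x l i)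
              - 2 * mc3 Φ x * ginv Φ x k j) • pd k Φ x) :
    ∀ x ∈ Disk,
      (Real.sqrt (gdet Φ x))⁻¹ •
          (∑ j : Fin 2, pd j (fun y => Real.sqrt (gdet Φ y) • W j y) x)
        = -((2 * α * mc3 Φ x) • nrm Φ x + β • nrm Φ x
            - (γ * ((1/2) * (∑ i : Fin 2, ∑ j : Fin 2, ∑ k : Fin 2, ∑ l : Fin 2,
                ginv Φ x i k * ginv Φ x j l * sff3 Φ x k j * sff3 Φ x l i)
              - 2 * mc3 Φ x ^ 2)) • nrm Φ x) := by
  have hdisk : IsOpen Disk := Metric.isOpen_ball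
  have hΦ' : ∀ y ∈ Disk, ContDiffAt ℝ (⊤ : ℕ∞) Φ y := fun y hy =>
    hΦ.contDiffAt (hdisk.mem_nhds hy)
  have hev : ∀ y ∈ Disk, ∀ᶠ z in nhds y, cross3 (pd 0 Φ z) (pd 1 Φ z) ≠ 0 := fun y hy =>
    Filter.eventually_of_mem (hdisk.mem_nhds hy) fun z hz => cross3_ne_zero (himm z hz)
  have hs : ∀ y ∈ Disk, Real.sqrt (gdet Φ y) ≠ 0 := fun y hy => by
    rw [sqrt_gdet]; exact norm_ne_zero_iff.2 (cross3_ne_zero (himm y hy))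
  have hW0 : ∀ y ∈ Disk, Real.sqrt (gdet Φ y) • W 0 y
      = α • cross3 (nrm Φ y) (pd 1 Φ y) + (-(β / 2)) • cross3 (Φ y) (pd 1 Φ y)
        + (-(γ / 2)) • cross3 (nrm Φ y) (pd 1 (nrm Φ) y) := by
    intro y hy
    obtain ⟨-, -, -, hsym, hd⟩ := gm_eq_ginv (hs y hy)
    rw [hW, cross3_nrm_pd_one (hs y hy), cross3_nrm_pd_nrm (hΦ' y hy) (hev y hy), mc3]
    simp only [Fin.sum_univ_two, hsym, sff3_comm (hΦ' y hy)]
    have := hs y hy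
    simp [eps]
    match_scalars <;> field_simp <;> ring
  have hW1 : ∀ y ∈ Disk, Real.sqrt (gdet Φ y) • W 1 y
      = (-α) • cross3 (nrm Φ y) (pd 0 Φ y) + (β / 2) • cross3 (Φ y) (pd 0 Φ y)
        + (γ / 2) • cross3 (nrm Φ y) (pd 0 (nrm Φ) y) := by
    intro y hy
    obtain ⟨-, -, -, hsym, hd⟩ := gm_eq_ginv (hs y hy)
    rw [hW, cross3_nrm_pd_zero (hs y hy), cross3_nrm_pd_nrm (hΦ' y hy) (hev y hy), mc3]
    simp only [Fin.sum_univ_two, hsym, sff3_comm (hΦ' y hy)]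
    have := hs y hy
    simp [eps]
    match_scalars <;> field_simp <;> ring
  intro x hx
  have hΦx := hΦ' x hx
  have hnx := contDiffAt_nrm hΦx (hev x hx).self_of_nhds
  have hcross : ∀ (f g : E2 → E3), ContDiffAt ℝ (⊤ : ℕ∞) f x → ContDiffAt ℝ (⊤ : ℕ∞) g x →
      ∀ (c : ℝ) (k : Fin 2), DifferentiableAt ℝ (fun y => c • cross3 (f y) (pd k g y)) x :=
    fun f g hf hg c k => ((hf.differentiableAt (by simp)).cross3
      ((contDiffAt_pd k hg).differentiableAt (by simp))).const_smul c
  have hpd : ∀ (a b c : ℝ) (j k : Fin 2),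
      pd j (fun y => a • cross3 (nrm Φ y) (pd k Φ y) + b • cross3 (Φ y) (pd k Φ y)
        + c • cross3 (nrm Φ y) (pd k (nrm Φ) y)) x
      = a • pd j (fun y => cross3 (nrm Φ y) (pd k Φ y)) x
        + b • pd j (fun y => cross3 (Φ y) (pd k Φ y)) x
        + c • pd j (fun y => cross3 (nrm Φ y) (pd k (nrm Φ) y)) x := by
    intro a b c j k
    have h1 := hcross _ _ hnx hΦx
    have h2 := hcross _ _ hΦx hΦx
    have h3 := hcross _ _ hnx hnx
    rw [pd_add j ((h1 a k).fun_add (h2 b k)) (h3 c k), pd_add j (h1 a k) (h2 b k),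
      pd_const_smul j a (by simpa using h1 1 k), pd_const_smul j b (by simpa using h2 1 k),
      pd_const_smul j c (by simpa using h3 1 k)]
  rw [Fin.sum_univ_two,
    pd_congr 0 (Filter.eventually_of_mem (hdisk.mem_nhds hx) hW0),
    pd_congr 1 (Filter.eventually_of_mem (hdisk.mem_nhds hx) hW1), hpd, hpd]
  have hdiv : ∀ A B C A' B' C' : E3,
      (α • A + (-(β / 2)) • B + (-(γ / 2)) • C) + ((-α) • A' + (β / 2) • B' + (γ / 2) • C')
        = α • (A - A') - (β / 2) • (B - B') - (γ / 2) • (C - C') := by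
    intros; module
  rw [hdiv, pd_cross3_pd_sub hnx hΦx, pd_cross3_pd_sub hΦx hΦx, pd_cross3_pd_sub hnx hnx,
    weingarten hΦx (hev x hx) 0, weingarten hΦx (hev x hx) 1, mc3]
  obtain ⟨-, -, -, hsym, hd⟩ := gm_eq_ginv (hs x hx)
  simp only [Fin.sum_univ_two, hsym, sff3_comm hΦx]
  simp only [← neg_one_smul ℝ (_ + _ : E3), cross3_smul_left, cross3_smul_right, cross3_add_left,
    cross3_add_right, cross3_self, cross3_anticomm (pd 0 Φ x) (pd 1 Φ x), cross3_pd_pd (hs x hx)]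
  have := hs x hx
  match_scalars
  field_simp
  ring
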